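/- Let n ≥ 2 be an integer and p ∈ (1,n) a real number. If C > 0 is a constant such that (∫_{ℝ^n} |f|^{p*} dx)^{1/p*} ≤ C · (∫_{ℝ^n} |∇f|^p dx)^{1/p} holds for every smooth compactly supported function f : ℝ^n → ℝ, then C ≥ AT(n,p). -/

import Mathlib

open Real MeasureTheory Filter Topology

/-- The volume of the unit ball in `ℝ^n`: `ω_n = π^(n/2) / Γ(n/2 + 1)`. -/
noncomputable def ballVol (n : ℕ) : ℝ := Real.pi ^ ((n : ℝ) / 2) / Real.Gamma ((n : ℝ) / 2 + 1)

/-- The Aubin–Talenti constant `AT(n,p)`. -/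
noncomputable def AT (n : ℕ) (p : ℝ) : ℝ :=
  Real.pi ^ (-(1 : ℝ) / 2) * (n : ℝ) ^ (-(1 / p)) *
    ((p - 1) / ((n : ℝ) - p)) ^ (1 / (p / (p - 1))) *
    (Real.Gamma (1 + (n : ℝ) / 2) * Real.Gamma (n : ℝ) /
      (Real.Gamma ((n : ℝ) / p) * Real.Gamma (1 + (n : ℝ) / (p / (p - 1))))) ^ (1 / (n : ℝ))

lemma integrableOn_rpow_mul_one_sub_rpow {a b : ℝ} (ha : 0 < a) (hb : 0 < b) :
    IntegrableOn (fun x : ℝ => x ^ (a - 1) * (1 - x) ^ (b - 1)) (Set.Ioo 0 1) := by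
  have h := Complex.betaIntegral_convergent (u := a) (v := b) (by simpa) (by simpa)
  rw [intervalIntegrable_iff_integrableOn_Ioo_of_le zero_le_one] at h
  refine IntegrableOn.congr_fun h.re (fun x hx => ?_) measurableSet_Ioo
  have h1 : (0 : ℝ) ≤ 1 - x := by linarith [hx.2]
  simp only [RCLike.re_to_complex]
  rw [← Complex.ofReal_one, ← Complex.ofReal_sub, ← Complex.ofReal_sub, ← Complex.ofReal_sub,
    ← Complex.ofReal_cpow hx.1.le, ← Complex.ofReal_cpow h1, ← Complex.ofReal_mul,
    Complex.ofReal_re]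

lemma integral_rpow_mul_one_sub_rpow {a b : ℝ} (ha : 0 < a) (hb : 0 < b) :
    ∫ x in Set.Ioo (0 : ℝ) 1, x ^ (a - 1) * (1 - x) ^ (b - 1) = ProbabilityTheory.beta a b := by
  have h := Complex.betaIntegral_convergent (u := a) (v := b) (by simpa) (by simpa)
  rw [intervalIntegrable_iff_integrableOn_Ioo_of_le zero_le_one] at h
  rw [ProbabilityTheory.beta_eq_betaIntegralReal a b ha hb, Complex.betaIntegral,
    intervalIntegral.integral_of_le zero_le_one, integral_Ioc_eq_integral_Ioo,
    ← RCLike.re_to_complex, ← integral_re h]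
  refine setIntegral_congr_fun measurableSet_Ioo fun x hx => ?_
  have h1 : (0 : ℝ) ≤ 1 - x := by linarith [hx.2]
  simp only [RCLike.re_to_complex]
  rw [← Complex.ofReal_one, ← Complex.ofReal_sub, ← Complex.ofReal_sub, ← Complex.ofReal_sub,
    ← Complex.ofReal_cpow hx.1.le, ← Complex.ofReal_cpow h1, ← Complex.ofReal_mul,
    Complex.ofReal_re]

lemma image_div_one_add_Ioi :
    (fun t : ℝ => t / (1 + t)) '' Set.Ioi 0 = Set.Ioo 0 1 := by
  ext y
  constructor
  · rintro ⟨t, ht, rfl⟩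
    have ht : 0 < t := ht
    exact ⟨by positivity, by rw [div_lt_one] <;> linarith⟩
  · rintro ⟨h0, h1⟩
    have h2 : 0 < 1 - y := by linarith
    refine ⟨y / (1 - y), by simpa using div_pos h0 h2, ?_⟩
    field_simp
    ring

lemma injOn_div_one_add_Ioi : Set.InjOn (fun t : ℝ => t / (1 + t)) (Set.Ioi 0) := by
  intro x hx y hy h
  have hx : 0 < x := hx
  have hy : 0 < y := hy
  simp only at h
  rw [div_eq_div_iff (by positivity) (by positivity)] at h
  linarith

lemma hasDerivWithinAt_div_one_add (t : ℝ) (ht : t ∈ Set.Ioi (0 : ℝ)) :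
    HasDerivWithinAt (fun t : ℝ => t / (1 + t)) (((1 + t) ^ 2)⁻¹) (Set.Ioi 0) t := by
  have ht : 0 < t := ht
  have h := (hasDerivAt_id t).div ((hasDerivAt_id t).const_add 1) (by simp; positivity)
  convert! h.hasDerivWithinAt using 1
  simp

lemma abs_deriv_smul_beta_integrand {a b t : ℝ} (ht : 0 < t) :
    |((1 + t) ^ 2)⁻¹| • ((t / (1 + t)) ^ (a - 1) * (1 - t / (1 + t)) ^ (b - 1)) =
      t ^ (a - 1) * (1 + t) ^ (-(a + b)) := by
  have h1 : 0 < 1 + t := by linarith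
  have h2 : 1 - t / (1 + t) = (1 + t)⁻¹ := by field_simp; ring
  rw [h2, abs_of_pos (by positivity), smul_eq_mul, div_rpow ht.le h1.le, inv_rpow h1.le,
    ← rpow_natCast, div_eq_mul_inv, ← rpow_neg h1.le, ← rpow_neg h1.le, ← rpow_neg h1.le,
    show -(a + b) = -((2 : ℕ) : ℝ) + (-(a - 1) + -(b - 1)) by push_cast; ring,
    rpow_add h1, rpow_add h1]
  ring

lemma integrableOn_rpow_mul_one_add_rpow {a b : ℝ} (ha : 0 < a) (hb : 0 < b) :
    IntegrableOn (fun t : ℝ => t ^ (a - 1) * (1 + t) ^ (-(a + b))) (Set.Ioi 0) := by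
  have h := integrableOn_rpow_mul_one_sub_rpow ha hb
  rw [← image_div_one_add_Ioi, integrableOn_image_iff_integrableOn_abs_deriv_smul
    measurableSet_Ioi hasDerivWithinAt_div_one_add injOn_div_one_add_Ioi] at h
  exact h.congr_fun (fun t ht => abs_deriv_smul_beta_integrand ht) measurableSet_Ioi

lemma integral_rpow_mul_one_add_rpow {a b : ℝ} (ha : 0 < a) (hb : 0 < b) :
    ∫ t in Set.Ioi (0 : ℝ), t ^ (a - 1) * (1 + t) ^ (-(a + b)) = ProbabilityTheory.beta a b := by
  rw [← integral_rpow_mul_one_sub_rpow ha hb, ← image_div_one_add_Ioi,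
    integral_image_eq_integral_abs_deriv_smul
      measurableSet_Ioi hasDerivWithinAt_div_one_add injOn_div_one_add_Ioi]
  exact setIntegral_congr_fun measurableSet_Ioi fun t ht => (abs_deriv_smul_beta_integrand ht).symm

lemma pow_smul_bubble_integrand {n : ℕ} (hn : 0 < n) {γ s b y : ℝ} (hs : 0 < s) (hy : 0 < y) :
    y ^ (n - 1) • (y ^ γ * (1 + y ^ s) ^ (-((n + γ) / s + b))) =
      y ^ (s - 1) • ((y ^ s) ^ ((n + γ) / s - 1) * (1 + y ^ s) ^ (-((n + γ) / s + b))) := by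
  rw [smul_eq_mul, smul_eq_mul, ← mul_assoc, ← mul_assoc, ← rpow_mul hy.le, ← rpow_natCast,
    ← rpow_add hy, ← rpow_add hy, Nat.cast_sub (Nat.one_le_iff_ne_zero.2 hn.ne')]
  congr 2
  push_cast
  field_simp
  ring

lemma integrable_norm_rpow_mul_one_add_norm_rpow {n : ℕ} (hn : 0 < n) {γ s b : ℝ} (hγ : 0 ≤ γ)
    (hs : 0 < s) (hb : 0 < b) :
    Integrable (fun x : EuclideanSpace ℝ (Fin n) =>
      ‖x‖ ^ γ * (1 + ‖x‖ ^ s) ^ (-((n + γ) / s + b))) := by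
  have : Nonempty (Fin n) := ⟨⟨0, hn⟩⟩
  have hn' : (0 : ℝ) < n := by exact_mod_cast hn
  rw [integrable_fun_norm_addHaar volume
    (f := fun r : ℝ => r ^ γ * (1 + r ^ s) ^ (-((n + γ) / s + b))), finrank_euclideanSpace_fin]
  have h := integrableOn_rpow_mul_one_add_rpow (a := (n + γ) / s) (b := b) (by positivity) hb
  rw [← integrableOn_Ioi_comp_rpow_iff' _ hs.ne'] at h
  exact h.congr_fun (fun y hy => (pow_smul_bubble_integrand hn hs hy).symm) measurableSet_Ioi

lemma integral_norm_rpow_mul_one_add_norm_rpow {n : ℕ} (hn : 0 < n) {γ s b : ℝ} (hγ : 0 ≤ γ)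
    (hs : 0 < s) (hb : 0 < b) :
    ∫ x : EuclideanSpace ℝ (Fin n), ‖x‖ ^ γ * (1 + ‖x‖ ^ s) ^ (-((n + γ) / s + b)) =
      n * (π ^ ((n : ℝ) / 2) / Gamma (n / 2 + 1)) *
        (ProbabilityTheory.beta ((n + γ) / s) b / s) := by
  have : Nonempty (Fin n) := ⟨⟨0, hn⟩⟩
  have hn' : (0 : ℝ) < n := by exact_mod_cast hn
  have hvol : volume.real (Metric.ball (0 : EuclideanSpace ℝ (Fin n)) 1) =
      π ^ ((n : ℝ) / 2) / Gamma (n / 2 + 1) := by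
    have : 0 < Gamma ((n : ℝ) / 2 + 1) := Gamma_pos_of_pos (by positivity)
    rw [measureReal_def, EuclideanSpace.volume_ball, Fintype.card_fin, ENNReal.ofReal_one, one_pow,
      one_mul, ENNReal.toReal_ofReal (by positivity), sqrt_eq_rpow, ← rpow_natCast,
      ← rpow_mul pi_pos.le]
    congr 2
    ring
  rw [integral_fun_norm_addHaar volume
    (fun r : ℝ => r ^ γ * (1 + r ^ s) ^ (-((n + γ) / s + b))), finrank_euclideanSpace_fin, hvol,
    nsmul_eq_mul, smul_eq_mul, ← mul_assoc]
  congr 1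
  rw [← integral_rpow_mul_one_add_rpow (by positivity) hb,
    ← integral_comp_rpow_Ioi_of_pos (g := fun t => t ^ ((n + γ) / s - 1) * (1 + t) ^ _) hs,
    eq_div_iff hs.ne', mul_comm, ← integral_const_mul]
  refine setIntegral_congr_fun measurableSet_Ioi fun y hy => ?_
  rw [pow_smul_bubble_integrand hn hs hy]
  simp only [smul_eq_mul]
  ring

/-- A smooth cutoff on `ℝ`, supported in `(1/k, k+1)` and equal to `1` on `[2/k, k]`. -/
noncomputable def smoothCutoff (k : ℕ) (s : ℝ) : ℝ :=
  smoothTransition (k * s - 1) * smoothTransition (k + 1 - s)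

lemma smoothCutoff_nonneg (k : ℕ) (s : ℝ) : 0 ≤ smoothCutoff k s :=
  mul_nonneg (smoothTransition.nonneg _) (smoothTransition.nonneg _)

lemma smoothCutoff_le_one (k : ℕ) (s : ℝ) : smoothCutoff k s ≤ 1 :=
  mul_le_one₀ (smoothTransition.le_one _) (smoothTransition.nonneg _) (smoothTransition.le_one _)

lemma smoothCutoff_eq_zero_of_mul_le_one {k : ℕ} {s : ℝ} (h : k * s ≤ 1) :
    smoothCutoff k s = 0 := by
  rw [smoothCutoff, smoothTransition.zero_of_nonpos (by linarith), zero_mul]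

lemma smoothCutoff_eq_zero_of_le {k : ℕ} {s : ℝ} (h : k + 1 ≤ s) : smoothCutoff k s = 0 := by
  rw [smoothCutoff, smoothTransition.zero_of_nonpos (x := k + 1 - s) (by linarith), mul_zero]

lemma smoothCutoff_eq_one {k : ℕ} {s : ℝ} (h : 2 ≤ k * s) (h' : s ≤ k) : smoothCutoff k s = 1 := by
  rw [smoothCutoff, smoothTransition.one_of_one_le (by linarith),
    smoothTransition.one_of_one_le (by linarith), mul_one]

lemma contDiff_smoothCutoff (k : ℕ) : ContDiff ℝ (⊤ : ℕ∞) (smoothCutoff k) :=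
  (smoothTransition.contDiff.comp (by fun_prop)).mul (smoothTransition.contDiff.comp (by fun_prop))

lemma contDiff_smoothCutoff_mul {ψ : ℝ → ℝ} (hψ : ContDiffOn ℝ (⊤ : ℕ∞) ψ (Set.Ioi 0)) (k : ℕ) :
    ContDiff ℝ (⊤ : ℕ∞) (fun s => smoothCutoff k s * ψ s) := by
  rw [contDiff_iff_contDiffAt]
  intro s
  rcases lt_or_ge 0 s with hs | hs
  · exact (contDiff_smoothCutoff k).contDiffAt.mul (hψ.contDiffAt (Ioi_mem_nhds hs))
  · have h1 : ∀ᶠ t : ℝ in 𝓝 s, k * t < 1 :=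
      (by fun_prop : Continuous fun t : ℝ => k * t).continuousAt.eventually_lt_const
        (by nlinarith [(Nat.cast_nonneg k : (0 : ℝ) ≤ k)])
    refine (contDiffAt_const (c := (0 : ℝ))).congr_of_eventuallyEq ?_
    filter_upwards [h1] with t ht
    rw [smoothCutoff_eq_zero_of_mul_le_one ht.le, zero_mul]

/-- The compactly supported primitive, vanishing at infinity, of `-ψ` cut off away from
`0` and `∞`. -/
noncomputable def cutoffPrimitive (ψ : ℝ → ℝ) (k : ℕ) (s : ℝ) : ℝ :=
  ∫ t in s..(k + 1), smoothCutoff k t * ψ t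

section
variable {ψ : ℝ → ℝ} {u : ℝ → ℝ}

lemma hasDerivAt_cutoffPrimitive (hψ : ContDiffOn ℝ (⊤ : ℕ∞) ψ (Set.Ioi 0)) (k : ℕ) (s : ℝ) :
    HasDerivAt (cutoffPrimitive ψ k) (-(smoothCutoff k s * ψ s)) s := by
  have h := (contDiff_smoothCutoff_mul hψ k).continuous
  exact intervalIntegral.integral_hasDerivAt_left (h.intervalIntegrable _ _)
    h.stronglyMeasurable.stronglyMeasurableAtFilter h.continuousAt

lemma contDiff_cutoffPrimitive (hψ : ContDiffOn ℝ (⊤ : ℕ∞) ψ (Set.Ioi 0)) (k : ℕ) :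
    ContDiff ℝ (⊤ : ℕ∞) (cutoffPrimitive ψ k) := by
  rw [contDiff_infty_iff_deriv]
  refine ⟨fun s => (hasDerivAt_cutoffPrimitive hψ k s).differentiableAt, ?_⟩
  rw [funext fun s => (hasDerivAt_cutoffPrimitive hψ k s).deriv]
  exact (contDiff_smoothCutoff_mul hψ k).neg

lemma cutoffPrimitive_eq_zero {k : ℕ} {s : ℝ} (hs : k + 1 ≤ s) : cutoffPrimitive ψ k s = 0 := by
  rw [cutoffPrimitive, intervalIntegral.integral_symm, neg_eq_zero]
  refine intervalIntegral.integral_zero_ae (Eventually.of_forall fun t ht => ?_)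
  rw [Set.uIoc_of_le hs] at ht
  rw [smoothCutoff_eq_zero_of_le ht.1.le, zero_mul]

lemma intervalIntegral_eq_sub_of_hasDerivAt_neg (hψ : ContDiffOn ℝ (⊤ : ℕ∞) ψ (Set.Ioi 0))
    (hu : ∀ s, 0 < s → HasDerivAt u (-ψ s) s) {a b : ℝ} (ha : 0 < a) (hab : a ≤ b) :
    IntervalIntegrable ψ volume a b ∧ ∫ t in a..b, ψ t = u a - u b := by
  have hpos : ∀ t ∈ Set.uIcc a b, 0 < t := fun t ht => by
    rw [Set.uIcc_of_le hab] at ht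
    exact ha.trans_le ht.1
  have hint : IntervalIntegrable ψ volume a b :=
    (hψ.continuousOn.mono fun t ht => hpos t ht).intervalIntegrable
  refine ⟨hint, ?_⟩
  have h := intervalIntegral.integral_eq_sub_of_hasDerivAt (fun t ht => hu t (hpos t ht)) hint.neg
  simp only [intervalIntegral.integral_neg] at h
  linarith

lemma cutoffPrimitive_nonneg (hψ0 : ∀ s, 0 < s → 0 ≤ ψ s)
    (k : ℕ) {s : ℝ} (hs : 0 < s) : 0 ≤ cutoffPrimitive ψ k s := by
  rcases le_total (k + 1 : ℝ) s with h | h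
  · rw [cutoffPrimitive_eq_zero h]
  · exact intervalIntegral.integral_nonneg h fun t ht =>
      mul_nonneg (smoothCutoff_nonneg k t) (hψ0 t (hs.trans_le ht.1))

lemma cutoffPrimitive_le (hψ : ContDiffOn ℝ (⊤ : ℕ∞) ψ (Set.Ioi 0))
    (hψ0 : ∀ s, 0 < s → 0 ≤ ψ s) (hu : ∀ s, 0 < s → HasDerivAt u (-ψ s) s)
    (hu0 : ∀ s, 0 < s → 0 ≤ u s)
    (k : ℕ) {s : ℝ} (hs : 0 < s) : cutoffPrimitive ψ k s ≤ u s := by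
  rcases le_total (k + 1 : ℝ) s with h | h
  · rw [cutoffPrimitive_eq_zero h]
    exact hu0 s hs
  · obtain ⟨hint, heq⟩ := intervalIntegral_eq_sub_of_hasDerivAt_neg hψ hu hs h
    have hle : cutoffPrimitive ψ k s ≤ ∫ t in s..(k + 1), ψ t := by
      refine intervalIntegral.integral_mono_on h
        ((contDiff_smoothCutoff_mul hψ k).continuous.intervalIntegrable _ _) hint fun t ht => ?_
      exact mul_le_of_le_one_left (hψ0 t (hs.trans_le ht.1)) (smoothCutoff_le_one k t)
    linarith [hu0 (k + 1) (by positivity)]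

lemma sub_le_cutoffPrimitive (hψ : ContDiffOn ℝ (⊤ : ℕ∞) ψ (Set.Ioi 0))
    (hψ0 : ∀ s, 0 < s → 0 ≤ ψ s) (hu : ∀ s, 0 < s → HasDerivAt u (-ψ s) s)
    {k : ℕ} {s : ℝ} (hs : 0 < s) (h2 : 2 ≤ k * s) (hsk : s ≤ k) :
    u s - u k ≤ cutoffPrimitive ψ k s := by
  obtain ⟨-, heq⟩ := intervalIntegral_eq_sub_of_hasDerivAt_neg hψ hu hs hsk
  have hc := (contDiff_smoothCutoff_mul hψ k).continuous
  have h0 : 0 ≤ ∫ t in (k : ℝ)..(k + 1), smoothCutoff k t * ψ t :=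
    intervalIntegral.integral_nonneg (by linarith) fun t ht =>
      mul_nonneg (smoothCutoff_nonneg k t) (hψ0 t (hs.trans_le (hsk.trans ht.1)))
  have h1 : ∫ t in s..k, smoothCutoff k t * ψ t = ∫ t in s..k, ψ t := by
    refine intervalIntegral.integral_congr fun t ht => ?_
    rw [Set.uIcc_of_le hsk] at ht
    rw [smoothCutoff_eq_one (h2.trans (by gcongr; exact ht.1)) ht.2, one_mul]
  rw [cutoffPrimitive, ← intervalIntegral.integral_add_adjacent_intervals
    (hc.intervalIntegrable s k) (hc.intervalIntegrable k (k + 1)), h1]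
  linarith

lemma tendsto_cutoffPrimitive (hψ : ContDiffOn ℝ (⊤ : ℕ∞) ψ (Set.Ioi 0))
    (hψ0 : ∀ s, 0 < s → 0 ≤ ψ s) (hu : ∀ s, 0 < s → HasDerivAt u (-ψ s) s)
    (hu0 : ∀ s, 0 < s → 0 ≤ u s)
    (hlim : Tendsto u atTop (𝓝 0)) {s : ℝ} (hs : 0 < s) :
    Tendsto (fun k => cutoffPrimitive ψ k s) atTop (𝓝 (u s)) := by
  have h1 : Tendsto (fun k : ℕ => u s - u k) atTop (𝓝 (u s)) := by
    simpa using (hlim.comp tendsto_natCast_atTop_atTop).const_sub (u s)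
  refine tendsto_of_tendsto_of_tendsto_of_le_of_le' h1 tendsto_const_nhds ?_
    (Eventually.of_forall fun k => cutoffPrimitive_le hψ hψ0 hu hu0 k hs)
  filter_upwards [tendsto_natCast_atTop_atTop.eventually_ge_atTop s,
    tendsto_natCast_atTop_atTop.eventually_ge_atTop (2 / s)] with k hk hk'
  exact sub_le_cutoffPrimitive hψ hψ0 hu hs ((div_le_iff₀ hs).1 hk') hk

variable {E : Type*} [NormedAddCommGroup E] [InnerProductSpace ℝ E]

lemma norm_fderiv_cutoffPrimitive_norm_sq (hψ : ContDiffOn ℝ (⊤ : ℕ∞) ψ (Set.Ioi 0))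
    (k : ℕ) (x : E) :
    ‖fderiv ℝ (fun y : E => cutoffPrimitive ψ k (‖y‖ ^ 2)) x‖ =
      smoothCutoff k (‖x‖ ^ 2) * (2 * ‖x‖ * |ψ (‖x‖ ^ 2)|) := by
  have h := (hasDerivAt_cutoffPrimitive hψ k (‖x‖ ^ 2)).comp_hasFDerivAt x
    (hasStrictFDerivAt_norm_sq x).hasFDerivAt
  rw [show (fun y : E => cutoffPrimitive ψ k (‖y‖ ^ 2)) =
    cutoffPrimitive ψ k ∘ fun y => ‖y‖ ^ 2 from rfl, h.fderiv, norm_smul,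
    ← Nat.cast_smul_eq_nsmul ℝ,
    norm_smul, innerSL_apply_norm, norm_neg, norm_mul, norm_eq_abs, norm_eq_abs,
    abs_of_nonneg (smoothCutoff_nonneg k _)]
  simp
  ring

/-- A Sobolev-type inequality for smooth compactly supported functions extends to decreasing
radial functions that are smooth away from the origin. -/
lemma sobolev_inequality_of_radial (hψ : ContDiffOn ℝ (⊤ : ℕ∞) ψ (Set.Ioi 0))
    (hψ0 : ∀ s, 0 < s → 0 ≤ ψ s) (hu : ∀ s, 0 < s → HasDerivAt u (-ψ s) s)
    (hu0 : ∀ s, 0 < s → 0 ≤ u s)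
    [FiniteDimensional ℝ E] [MeasurableSpace E] [BorelSpace E] {μ : Measure E}
    [NullSingletonClass μ] {p q C : ℝ} (hp : 0 < p) (hq : 0 < q) (hC : 0 ≤ C)
    (hineq : ∀ f : E → ℝ, ContDiff ℝ (⊤ : ℕ∞) f → HasCompactSupport f →
      (∫ x, |f x| ^ q ∂μ) ^ q⁻¹ ≤ C * (∫ x, ‖fderiv ℝ f x‖ ^ p ∂μ) ^ p⁻¹)
    (hlim : Tendsto u atTop (𝓝 0))
    (hIu : Integrable (fun x => u (‖x‖ ^ 2) ^ q) μ)
    (hIψ : Integrable (fun x => (2 * ‖x‖ * |ψ (‖x‖ ^ 2)|) ^ p) μ) :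
    (∫ x, u (‖x‖ ^ 2) ^ q ∂μ) ^ q⁻¹ ≤
      C * (∫ x, (2 * ‖x‖ * |ψ (‖x‖ ^ 2)|) ^ p ∂μ) ^ p⁻¹ := by
  set f : ℕ → E → ℝ := fun k x => cutoffPrimitive ψ k (‖x‖ ^ 2) with hf
  have hsmooth : ∀ k, ContDiff ℝ (⊤ : ℕ∞) (f k) := fun k =>
    (contDiff_cutoffPrimitive hψ k).comp (contDiff_norm_sq ℝ)
  have hsupp : ∀ k, HasCompactSupport (f k) := fun k => by
    refine HasCompactSupport.intro (isCompact_closedBall (0 : E) (k + 1)) fun x hx => ?_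
    have hx : k + 1 < ‖x‖ := by simpa using hx
    exact cutoffPrimitive_eq_zero (by nlinarith [(Nat.cast_nonneg k : (0 : ℝ) ≤ k)])
  have hfd : ∀ k x, ‖fderiv ℝ (f k) x‖ =
      smoothCutoff k (‖x‖ ^ 2) * (2 * ‖x‖ * |ψ (‖x‖ ^ 2)|) := fun k x =>
    norm_fderiv_cutoffPrimitive_norm_sq hψ k x
  have hne : ∀ᵐ x ∂μ, 0 < ‖x‖ ^ 2 := by
    filter_upwards [compl_mem_ae_iff.2 (measure_singleton (μ := μ) (0 : E))] with x hx
    have : x ≠ 0 := hx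
    positivity
  have hL : Tendsto (fun k => ∫ x, |f k x| ^ q ∂μ) atTop (𝓝 (∫ x, u (‖x‖ ^ 2) ^ q ∂μ)) := by
    refine tendsto_integral_of_dominated_convergence _ (fun k => ?_) hIu (fun k => ?_) ?_
    · exact ((hsmooth k).continuous.abs.rpow_const fun _ => Or.inr hq.le).aestronglyMeasurable
    · filter_upwards [hne] with x hx
      have h0 := cutoffPrimitive_nonneg hψ0 k hx
      rw [norm_of_nonneg (by positivity), abs_of_nonneg h0]
      exact rpow_le_rpow h0 (cutoffPrimitive_le hψ hψ0 hu hu0 k hx) hq.le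
    · filter_upwards [hne] with x hx
      have h := (tendsto_cutoffPrimitive hψ hψ0 hu hu0 hlim hx).abs.rpow_const
        (p := q) (Or.inr hq.le)
      rwa [abs_of_nonneg (hu0 _ hx)] at h
  refine le_of_tendsto (hL.rpow_const (Or.inr (by positivity))) (Eventually.of_forall fun k => ?_)
  refine (hineq (f k) (hsmooth k) (hsupp k)).trans ?_
  gcongr ?_ * ?_ ^ _
  refine integral_mono_of_nonneg (Eventually.of_forall fun x => by positivity) hIψ
    (Eventually.of_forall fun x => ?_)
  simp only [hfd]
  exact rpow_le_rpow (mul_nonneg (smoothCutoff_nonneg k _) (by positivity))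
    (mul_le_of_le_one_left (by positivity) (smoothCutoff_le_one k _)) hp.le
end

lemma hasDerivAt_one_add_rpow_rpow (a b : ℝ) {s : ℝ} (hs : 0 < s) :
    HasDerivAt (fun s : ℝ => (1 + s ^ a) ^ (-b))
      (-(a * b * s ^ (a - 1) * (1 + s ^ a) ^ (-b - 1))) s := by
  have h1 : 0 < 1 + s ^ a := by positivity
  have h := ((hasDerivAt_rpow_const (p := a) (Or.inl hs.ne')).const_add 1).rpow_const
    (p := -b) (Or.inl h1.ne')
  convert! h using 1
  ring

lemma contDiffOn_rpow_mul_one_add_rpow_rpow (a b c : ℝ) :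
    ContDiffOn ℝ (⊤ : ℕ∞) (fun s : ℝ => c * s ^ a * (1 + s ^ (a + 1)) ^ b) (Set.Ioi 0) := by
  intro s hs
  have hs : 0 < s := hs
  have h (a : ℝ) : ContDiffWithinAt ℝ (⊤ : ℕ∞) (fun s : ℝ => s ^ a) (Set.Ioi 0) s :=
    contDiffWithinAt_id.rpow_const_of_ne hs.ne'
  exact (contDiffWithinAt_const.mul (h a)).mul
    ((contDiffWithinAt_const.add (h (a + 1))).rpow_const_of_ne (by positivity))

lemma tendsto_one_add_rpow_rpow {a b : ℝ} (ha : 0 < a) (hb : 0 < b) :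
    Tendsto (fun s : ℝ => (1 + s ^ a) ^ (-b)) atTop (𝓝 0) :=
  (tendsto_rpow_neg_atTop hb).comp (tendsto_atTop_add_const_left _ _ (tendsto_rpow_atTop ha))

lemma sq_rpow_div_two {r : ℝ} (hr : 0 ≤ r) (s : ℝ) : (r ^ 2) ^ (s / 2) = r ^ s := by
  rw [← rpow_natCast, ← rpow_mul hr]
  congr 1
  push_cast
  ring

/-- The integral of `(1 + ‖x‖ ^ p') ^ (-n)` in terms of `Γ`. -/
lemma ballVol_mul_beta {n : ℕ} {p : ℝ} (hp : 1 < p) (hpn : p < n) :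
    n * ballVol n * (ProbabilityTheory.beta (n / (p / (p - 1))) (n / p) / (p / (p - 1))) =
      π ^ ((n : ℝ) / 2) * (Gamma (1 + (n : ℝ) / 2) * Gamma n /
      (Gamma (n / p) * Gamma (1 + n / (p / (p - 1)))))⁻¹ := by
  have h1 : 0 < p - 1 := by linarith
  have h2 : 0 < p := by linarith
  have h3 : (0 : ℝ) < n := by linarith
  have e : n / (p / (p - 1)) + n / p = n := by field_simp; ring
  have e2 : Gamma (1 + n / (p / (p - 1))) = n / (p / (p - 1)) * Gamma (n / (p / (p - 1))) := by
    rw [add_comm, Gamma_add_one (by positivity)]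
  rw [ballVol, ProbabilityTheory.beta, e, e2, add_comm 1]
  have : 0 < Gamma ((n : ℝ) / 2 + 1) := Gamma_pos_of_pos (by positivity)
  have : 0 < Gamma (n : ℝ) := Gamma_pos_of_pos (by positivity)
  have : 0 < Gamma (n / p : ℝ) := Gamma_pos_of_pos (by positivity)
  have : 0 < Gamma (n / (p / (p - 1)) : ℝ) := Gamma_pos_of_pos (by positivity)
  generalize Gamma (n / (p / (p - 1))) = g at *
  field_simp

lemma rpow_mul_beta_eq {n p : ℝ} (hp : 1 < p) (hpn : p < n) :
    ((n - p) / (p - 1)) ^ p * ProbabilityTheory.beta ((n + p / (p - 1)) / (p / (p - 1))) (n / p - 1)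
      = n * ((n - p) / (p - 1)) ^ (p - 1) *
        ProbabilityTheory.beta (n / (p / (p - 1))) (n / p) := by
  have h1 : 0 < p - 1 := by linarith
  have h2 : 0 < p := by linarith
  have h3 : 0 < n := by linarith
  have h4 : 0 < n - p := by linarith
  have h5 : 0 < n / p - 1 := by rw [sub_pos, lt_div_iff₀ h2]; linarith
  have e1 : (n + p / (p - 1)) / (p / (p - 1)) = n / (p / (p - 1)) + 1 := by field_simp
  have e2 : Gamma (n / p) = (n / p - 1) * Gamma (n / p - 1) := by
    rw [← Gamma_add_one h5.ne', sub_add_cancel]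
  rw [ProbabilityTheory.beta, ProbabilityTheory.beta, e1, Gamma_add_one (by positivity), e2,
    rpow_sub_one (by positivity)]
  rw [show n / (p / (p - 1)) + 1 + (n / p - 1) = n / (p / (p - 1)) + n / p by ring]
  have : 0 < Gamma (n / (p / (p - 1)) + n / p : ℝ) := Gamma_pos_of_pos (by positivity)
  generalize Gamma (n / (p / (p - 1)) + n / p) = g at *
  generalize Gamma (n / (p / (p - 1))) = g' at *
  generalize Gamma (n / p - 1) = g'' at *
  field_simp

lemma AT_mul_rpow_eq {n : ℕ} {p A B : ℝ} (hp : 1 < p) (hpn : p < n)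
    (hA : A = π ^ ((n : ℝ) / 2) * (Gamma (1 + (n : ℝ) / 2) * Gamma n /
      (Gamma (n / p) * Gamma (1 + n / (p / (p - 1)))))⁻¹)
    (hB : B = n * ((n - p) / (p - 1)) ^ (p - 1) * A) :
    AT n p * B ^ p⁻¹ = A ^ (p * n / (n - p))⁻¹ := by
  have h1 : 0 < p - 1 := by linarith
  have h2 : 0 < p := by linarith
  have h3 : (0 : ℝ) < n := by linarith
  have h4 : 0 < n - p := by linarith
  have : 0 < Gamma (1 + (n : ℝ) / 2) := Gamma_pos_of_pos (by positivity)
  have : 0 < Gamma (n : ℝ) := Gamma_pos_of_pos (by positivity)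
  have : 0 < Gamma (n / p : ℝ) := Gamma_pos_of_pos (by positivity)
  have : 0 < Gamma (1 + n / (p / (p - 1)) : ℝ) := Gamma_pos_of_pos (by positivity)
  set G := Gamma (1 + (n : ℝ) / 2) * Gamma n / (Gamma (n / p) * Gamma (1 + n / (p / (p - 1))))
    with hG
  have hG0 : 0 < G := by positivity
  have hA0 : 0 < A := by rw [hA]; positivity
  have hAT : AT n p = A ^ (-(1 / n : ℝ)) * ((n : ℝ) * ((n - p) / (p - 1)) ^ (p - 1)) ^ (-p⁻¹) := by
    rw [hA, mul_rpow (by positivity) (by positivity), inv_rpow hG0.le, ← rpow_neg hG0.le, neg_neg,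
      ← rpow_mul pi_pos.le, mul_rpow (by positivity) (by positivity), ← rpow_mul (by positivity),
      AT, ← hG, ← inv_div ((n : ℝ) - p), inv_rpow (by positivity), ← rpow_neg (by positivity),
      show (n : ℝ) / 2 * -(1 / n) = -1 / 2 by field_simp,
      show -(1 / (p / (p - 1))) = (p - 1) * -p⁻¹ by field_simp, one_div p]
    ring
  rw [hAT, hB, mul_rpow (by positivity) hA0.le, rpow_neg (by positivity) p⁻¹]
  have hK : 0 < ((n : ℝ) * ((n - p) / (p - 1)) ^ (p - 1)) ^ p⁻¹ := by positivity
  rw [show (p * n / (n - p))⁻¹ = -(1 / n : ℝ) + p⁻¹ by field_simp; ring, rpow_add hA0]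
  field_simp

/-- Sharpness of the Aubin–Talenti constant in the `L^p`-Sobolev inequality in `ℝ^n`. -/
theorem sharp_Lp_sobolev_euclidean_sharpness (n : ℕ) (hn : 2 ≤ n) (p : ℝ) (hp : 1 < p)
    (hpn : p < n) (C : ℝ) (hC : 0 < C)
    (hineq : ∀ f : EuclideanSpace ℝ (Fin n) → ℝ, ContDiff ℝ (⊤ : ℕ∞) f → HasCompactSupport f →
      (∫ x : EuclideanSpace ℝ (Fin n), |f x| ^ (p * n / ((n : ℝ) - p))) ^
          (((n : ℝ) - p) / (p * n)) ≤
        C * (∫ x : EuclideanSpace ℝ (Fin n), ‖fderiv ℝ f x‖ ^ p) ^ (1 / p)) :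
    AT n p ≤ C := by
  have h1 : 0 < p - 1 := by linarith
  have h2 : 0 < p := by linarith
  have h3 : (0 : ℝ) < n := by linarith
  have h4 : 0 < n - p := by linarith
  have h5 : 0 < n / p - 1 := by rw [sub_pos, lt_div_iff₀ h2]; linarith
  have hn0 : 0 < n := by omega
  have : Nonempty (Fin n) := ⟨⟨0, hn0⟩⟩
  set s : ℝ := p / (p - 1) with hs
  have hs0 : 0 < s := by positivity
  set b : ℝ := (n - p) / p with hb
  have hb0 : 0 < b := by positivity
  set u : ℝ → ℝ := fun t => (1 + t ^ (s / 2)) ^ (-b) with hu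
  set ψ : ℝ → ℝ := fun t => s / 2 * b * t ^ (s / 2 - 1) * (1 + t ^ (s / 2)) ^ (-b - 1) with hψ
  have hueq (x : EuclideanSpace ℝ (Fin n)) : u (‖x‖ ^ 2) ^ (p * n / (n - p)) =
      ‖x‖ ^ (0 : ℝ) * (1 + ‖x‖ ^ s) ^ (-((n + 0) / s + n / p)) := by
    simp only [hu]
    rw [sq_rpow_div_two (norm_nonneg x), ← rpow_mul (by positivity), rpow_zero, one_mul]
    congr 1
    rw [hb, hs]
    field_simp
    ring
  have hψeq (x : EuclideanSpace ℝ (Fin n)) : (2 * ‖x‖ * |ψ (‖x‖ ^ 2)|) ^ p =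
      ((n - p) / (p - 1)) ^ p *
        (‖x‖ ^ s * (1 + ‖x‖ ^ s) ^ (-((n + s) / s + (n / p - 1)))) := by
    rcases eq_or_ne x 0 with rfl | hx
    · simp [zero_rpow h2.ne', zero_rpow hs0.ne']
    have hx : 0 < ‖x‖ := by positivity
    have e : 2 * ‖x‖ * |ψ (‖x‖ ^ 2)| =
        (n - p) / (p - 1) * (‖x‖ ^ (s - 1) * (1 + ‖x‖ ^ s) ^ (-b - 1)) := by
      simp only [hψ]
      rw [abs_of_nonneg (by positivity), rpow_sub_one (by positivity),
        sq_rpow_div_two hx.le, rpow_sub_one hx.ne', hb]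
      rw [show (n - p) / (p - 1) = s * b by rw [hs, hb]; field_simp, hb]
      field_simp
    rw [e, mul_rpow (by positivity) (by positivity), mul_rpow (by positivity) (by positivity),
      ← rpow_mul hx.le, ← rpow_mul (by positivity)]
    congr 3
    · rw [hs]
      field_simp
      ring
    · rw [hb, hs]
      field_simp
      ring
  have key := sobolev_inequality_of_radial (E := EuclideanSpace ℝ (Fin n)) (μ := volume)
    (ψ := ψ) (u := u) (p := p) (q := p * n / (n - p)) (C := C)
    (by simpa [hψ] using contDiffOn_rpow_mul_one_add_rpow_rpow (s / 2 - 1) (-b - 1) (s / 2 * b))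
    (fun t ht => by positivity) (fun t ht => hasDerivAt_one_add_rpow_rpow (s / 2) b ht)
    (fun t ht => by positivity) h2 (by positivity) hC.le
    (fun f hf hf' => by simpa only [inv_div, one_div] using hineq f hf hf')
    (tendsto_one_add_rpow_rpow (by positivity) hb0)
    (by
      simp only [hueq]
      exact integrable_norm_rpow_mul_one_add_norm_rpow hn0 le_rfl hs0 (by positivity))
    (by
      simp only [hψeq]
      exact (integrable_norm_rpow_mul_one_add_norm_rpow hn0 hs0.le hs0 h5).const_mul _)
  simp only [hueq, hψeq] at key
  rw [integral_const_mul, integral_norm_rpow_mul_one_add_norm_rpow hn0 le_rfl hs0 (by positivity),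
    integral_norm_rpow_mul_one_add_norm_rpow hn0 hs0.le hs0 h5, add_zero, ← ballVol] at key
  have hB : ((n - p) / (p - 1)) ^ p *
      (n * ballVol n * (ProbabilityTheory.beta ((n + s) / s) (n / p - 1) / s)) =
      n * ((n - p) / (p - 1)) ^ (p - 1) *
        (n * ballVol n * (ProbabilityTheory.beta (n / s) (n / p) / s)) := by
    linear_combination (n * ballVol n / s) * rpow_mul_beta_eq hp hpn
  rw [← AT_mul_rpow_eq hp hpn (ballVol_mul_beta hp hpn) hB] at key
  refine le_of_mul_le_mul_right key (rpow_pos_of_pos ?_ _)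
  have h6 : 0 < ballVol n := div_pos (by positivity) (Gamma_pos_of_pos (by positivity))
  have h7 := ProbabilityTheory.beta_pos (show 0 < (n + s) / s by positivity) h5
  positivity
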